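/- In the prover–adversary game for the bracket axioms on strings of length n, the prover has a strategy that, against every adversary, forces the game to end (i.e., reaches a state falsifying one of the axioms (A1)–(A4)) while the memory size of the state never exceeds a·log n, for an absolute constant a. -/

import Mathlib

namespace Paper


/-! ### Bracket symbols, partial states, and the bracket axioms (A1)-(A4) -/

inductive BType : Type
  | trivR | trivB | openR | openB | closeR | closeB
  deriving DecidableEq

structure Sym (n : ℕ) where
  b : BType
  p : Fin n
  deriving DecidableEq

/-- Partial assignment of bracket symbols to positions (`none` = `*`). -/
abbrev PState (n : ℕ) := Fin n → Option (Sym n)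

/-- Positions `i` and `j` are paired (pointers point at each other). -/
def Paired {n : ℕ} (ρ : PState n) (i j : Fin n) : Prop :=
  ∃ σ τ : Sym n, ρ i = some σ ∧ ρ j = some τ ∧ σ.p = j ∧ τ.p = i

/-- Axiom (A1) is falsified: start/end of string condition fails on assigned entries. -/
def ViolA1 {n : ℕ} (ρ : PState n) : Prop :=
  (∃ i : Fin n, (i : ℕ) = 0 ∧ ∃ σ, ρ i = some σ ∧ ¬(σ.b = BType.trivR ∨ σ.b = BType.openR)) ∨
  (∃ i : Fin n, (i : ℕ) = n - 1 ∧ ∃ σ, ρ i = some σ ∧ ¬(σ.b = BType.trivB ∨ σ.b = BType.closeB))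

/-- Axiom (A2) is falsified: pointers fail to define colour-matched bracket pairs. -/
def ViolA2 {n : ℕ} (ρ : PState n) : Prop :=
  (∃ i j : Fin n, ∃ σ τ : Sym n, ρ i = some σ ∧ ρ j = some τ ∧ σ.p = j ∧ τ.p ≠ i) ∨
  (∃ i : Fin n, ∃ σ : Sym n, ρ i = some σ ∧ σ.p = i ∧
    ¬(σ.b = BType.trivR ∨ σ.b = BType.trivB)) ∨
  (∃ i j : Fin n, ∃ σ τ : Sym n, i < j ∧ ρ i = some σ ∧ ρ j = some τ ∧ σ.p = j ∧ τ.p = i ∧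
    ¬((σ.b = BType.openR ∧ τ.b = BType.closeR) ∨ (σ.b = BType.openB ∧ τ.b = BType.closeB)))

/-- Axiom (A3) is falsified: two pairs are incorrectly nested. -/
def ViolA3 {n : ℕ} (ρ : PState n) : Prop :=
  ∃ i i' j j' : Fin n, Paired ρ i j ∧ Paired ρ i' j' ∧ i < i' ∧ i' < j ∧ j < j'

/-- Axiom (A4) is falsified: a red-to-blue transition occurs at consecutive indices. -/
def ViolA4 {n : ℕ} (ρ : PState n) : Prop :=
  ∃ i j : Fin n, (j : ℕ) = (i : ℕ) + 1 ∧ ∃ σ τ : Sym n, ρ i = some σ ∧ ρ j = some τ ∧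
    (σ.b = BType.closeR ∨ σ.b = BType.trivR) ∧ (τ.b = BType.openB ∨ τ.b = BType.trivB)

/-- The partial state falsifies one of the axioms (A1)-(A4). -/
def Falsifies {n : ℕ} (ρ : PState n) : Prop := ViolA1 ρ ∨ ViolA2 ρ ∨ ViolA3 ρ ∨ ViolA4 ρ

/-- A partial assignment is consistent if it falsifies no axiom. -/
def ConsistentPS {n : ℕ} (ρ : PState n) : Prop := ¬ Falsifies ρ


/-! ### The prover-adversary game for the bracket axioms -/

inductive PMove (n : ℕ) : Type
  | query (i : Fin n)
  | forget (S : Finset (Fin n))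

/-- A history of the game: each round records the prover's move and,
for a query, the adversary's answer. -/
abbrev Hist (n : ℕ) := List (PMove n × Option (Sym n))

def stepState {n : ℕ} (ρ : PState n) : PMove n × Option (Sym n) → PState n
  | (PMove.query i, some σ) => Function.update ρ i (some σ)
  | (PMove.query _, none) => ρ
  | (PMove.forget S, _) => fun j => if j ∈ S then none else ρ j

/-- The game state after a given history (initially everything is `*`). -/
def stateOf {n : ℕ} (h : Hist n) : PState n := h.foldl stepState (fun _ => none)

/-- A (history-dependent) prover strategy. -/
abbrev ProverStrat (n : ℕ) := Hist n → PMove n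

/-- A (history-dependent) adversary strategy: answers queried indices with symbols. -/
abbrev AdvStrat (n : ℕ) := Hist n → Fin n → Sym n

/-- The history of the play between a prover and an adversary after `t` rounds. -/
def play {n : ℕ} (P : ProverStrat n) (A : AdvStrat n) : ℕ → Hist n
  | 0 => []
  | t + 1 =>
    let h := play P A t
    match P h with
    | PMove.query i => h ++ [(PMove.query i, some (A h i))]
    | PMove.forget S => h ++ [(PMove.forget S, none)]

/-- Memory size of a state: the number of assigned (non-`*`) entries. -/
noncomputable def memSize {n : ℕ} (ρ : PState n) : ℕ := {i : Fin n | ρ i ≠ none}.ncard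


/-! ### Positions from which the prover wins with bounded memory -/

/-- The prover can force a falsified axiom from `ρ` while never storing more than `M` entries. -/
inductive Wins {n : ℕ} (M : ℕ) : PState n → Prop
  | done {ρ} : memSize ρ ≤ M → Falsifies ρ → Wins M ρ
  | query {ρ} (i : Fin n) : memSize ρ ≤ M →
      (∀ σ, Wins M (Function.update ρ i (some σ))) → Wins M ρ
  | forget {ρ} (S : Finset (Fin n)) : memSize ρ ≤ M →
      Wins M (fun j => if j ∈ S then none else ρ j) → Wins M ρ

/-- A play unfolds at its first round: a query `i` is answered by `A [] i`. -/
theorem play_succ_of_query {n : ℕ} {P : ProverStrat n} {i : Fin n} (hP : P [] = PMove.query i)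
    (A : AdvStrat n) (t : ℕ) :
    play P A (t + 1) = (PMove.query i, some (A [] i)) ::
      play (fun h => P ((PMove.query i, some (A [] i)) :: h))
        (fun h => A ((PMove.query i, some (A [] i)) :: h)) t := by
  induction t with
  | zero => simp [play, hP]
  | succ t ih =>
    rw [play, ih]
    simp only [play]
    split <;> simp

/-- A play unfolds at its first round when that round forgets a set of indices. -/
theorem play_succ_of_forget {n : ℕ} {P : ProverStrat n} {S : Finset (Fin n)}
    (hP : P [] = PMove.forget S) (A : AdvStrat n) (t : ℕ) :
    play P A (t + 1) = (PMove.forget S, none) ::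
      play (fun h => P ((PMove.forget S, none) :: h))
        (fun h => A ((PMove.forget S, none) :: h)) t := by
  induction t with
  | zero => simp [play, hP]
  | succ t ih =>
    rw [play, ih]
    simp only [play]
    split <;> simp

theorem Wins.exists_strategy {n M : ℕ} {ρ : PState n} (h : Wins M ρ) :
    ∃ P : ProverStrat n, ∀ A : AdvStrat n, ∃ T : ℕ,
      Falsifies ((play P A T).foldl stepState ρ) ∧
      ∀ t ≤ T, memSize ((play P A t).foldl stepState ρ) ≤ M := by
  induction h with
  | done hM hF =>
    refine ⟨fun _ => PMove.forget ∅, fun A => ⟨0, hF, fun t ht => ?_⟩⟩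
    obtain rfl : t = 0 := by omega
    exact hM
  | query i hM _ ih =>
    choose Q hQ using ih
    let P : ProverStrat n := fun h => match h with
      | (_, some σ) :: h' => Q σ h'
      | _ => PMove.query i
    refine ⟨P, fun A => ?_⟩
    have hP : P [] = PMove.query i := rfl
    obtain ⟨T, hF, hT⟩ := hQ (A [] i) (fun h => A ((PMove.query i, some (A [] i)) :: h))
    refine ⟨T + 1, ?_, fun t ht => ?_⟩
    · rw [play_succ_of_query hP]
      exact hF
    · cases t with
      | zero => exact hM
      | succ t =>
        rw [play_succ_of_query hP]
        exact hT t (by omega)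
  | forget S hM _ ih =>
    obtain ⟨Q, hQ⟩ := ih
    let P : ProverStrat n := fun h => match h with
      | _ :: h' => Q h'
      | [] => PMove.forget S
    refine ⟨P, fun A => ?_⟩
    have hP : P [] = PMove.forget S := rfl
    obtain ⟨T, hF, hT⟩ := hQ (fun h => A ((PMove.forget S, none) :: h))
    refine ⟨T + 1, ?_, fun t ht => ?_⟩
    · rw [play_succ_of_forget hP]
      exact hF
    · cases t with
      | zero => exact hM
      | succ t =>
        rw [play_succ_of_forget hP]
        exact hT t (by omega)

theorem memSize_update_le {n : ℕ} (ρ : PState n) (i : Fin n) (σ : Option (Sym n)) :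
    memSize (Function.update ρ i σ) ≤ memSize ρ + 1 := by
  refine (Set.ncard_le_ncard (t := insert i {j | ρ j ≠ none}) ?_ (Set.toFinite _)).trans
    (Set.ncard_insert_le _ _)
  intro j hj
  by_cases hji : j = i
  · exact Or.inl hji
  · exact Or.inr (by simpa [hji] using hj)

/-! ### Blocks: matched pairs of brackets and trivial brackets -/

/-- The symbol at the left end of a block `[a, b]`; the colour is red iff `red` is true. -/
def leftSym {n : ℕ} (red : Bool) (a b : Fin n) : Sym n :=
  ⟨if a = b then bif red then .trivR else .trivB else bif red then .openR else .openB, b⟩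

/-- The symbol at the right end of a block `[a, b]`; the colour is red iff `red` is true. -/
def rightSym {n : ℕ} (red : Bool) (a b : Fin n) : Sym n :=
  ⟨if a = b then bif red then .trivR else .trivB else bif red then .closeR else .closeB, a⟩

/-- Store the two ends of a block `[a, b]`. -/
def addBlock {n : ℕ} (ρ : PState n) (red : Bool) (a b : Fin n) : PState n :=
  Function.update (Function.update ρ b (some (rightSym red a b))) a (some (leftSym red a b))

section addBlock

variable {n : ℕ} {ρ : PState n} {red : Bool} {a b : Fin n}

theorem addBlock_left : addBlock ρ red a b a = some (leftSym red a b) := by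
  simp [addBlock]

theorem addBlock_right : addBlock ρ red a b b = some (rightSym red a b) := by
  by_cases h : b = a
  · subst h
    simp [addBlock, leftSym, rightSym]
  · simp [addBlock, h]

theorem addBlock_of_ne {x : Fin n} (ha : x ≠ a) (hb : x ≠ b) : addBlock ρ red a b x = ρ x := by
  simp [addBlock, ha, hb]

theorem addBlock_of_some {x : Fin n} {σ : Sym n} (ha : ρ a = none) (hb : ρ b = none)
    (hx : ρ x = some σ) : addBlock ρ red a b x = some σ := by
  rw [addBlock_of_ne _ _, hx]
  · rintro rfl
    simp [ha] at hx
  · rintro rfl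
    simp [hb] at hx

theorem addBlock_eq_none {x : Fin n} (h : addBlock ρ red a b x = none) :
    x ≠ a ∧ x ≠ b ∧ ρ x = none := by
  have ha : x ≠ a := by
    rintro rfl
    simp [addBlock_left] at h
  have hb : x ≠ b := by
    rintro rfl
    simp [addBlock_right] at h
  exact ⟨ha, hb, by rwa [addBlock_of_ne ha hb] at h⟩

theorem memSize_addBlock_le : memSize (addBlock ρ red a b) ≤ memSize ρ + 2 :=
  (memSize_update_le _ _ _).trans (Nat.succ_le_succ (memSize_update_le _ _ _))

theorem paired_addBlock : Paired (addBlock ρ red a b) a b :=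
  ⟨_, _, addBlock_left, addBlock_right, rfl, rfl⟩

theorem Paired.addBlock {x y : Fin n} (h : Paired ρ x y) (ha : ρ a = none) (hb : ρ b = none) :
    Paired (addBlock ρ red a b) x y := by
  obtain ⟨σ, τ, hx, hy, hσ, hτ⟩ := h
  exact ⟨σ, τ, addBlock_of_some ha hb hx, addBlock_of_some ha hb hy, hσ, hτ⟩

/-- Forgetting an older block and keeping a newer, disjoint one. -/
theorem forget_addBlock_addBlock {red' : Bool} {d e : Fin n} (ha : ρ a = none) (hb : ρ b = none)
    (hd : addBlock ρ red a b d = none) (he : addBlock ρ red a b e = none) :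
    (fun j => if j ∈ ({a, b} : Finset (Fin n)) then none
      else addBlock (addBlock ρ red a b) red' d e j) = addBlock ρ red' d e := by
  obtain ⟨hda, hdb, -⟩ := addBlock_eq_none hd
  obtain ⟨hea, heb, -⟩ := addBlock_eq_none he
  funext j
  by_cases hja : j = a
  · subst hja
    simp [addBlock_of_ne hda.symm hea.symm, ha]
  by_cases hjb : j = b
  · subst hjb
    simp [addBlock_of_ne hdb.symm heb.symm, hb]
  by_cases hjd : j = d
  · subst hjd
    simp [hja, hjb, addBlock_left]
  by_cases hje : j = e
  · subst hje
    simp [hja, hjb, addBlock_right]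
  simp [hja, hjb, addBlock_of_ne hjd hje, addBlock_of_ne hja hjb]

end addBlock

/-! ### The halving strategy -/

/-- The free positions `L ≤ x < R` lie between a red block (or the start of the string) and a blue
block (or its end), none of them is stored, and the stored positions are closed under pointers. -/
structure Gap {n : ℕ} (ρ : PState n) (L R : ℕ) : Prop where
  le : L ≤ R
  le_length : R ≤ n
  closed : ∀ i σ, ρ i = some σ → ρ σ.p ≠ none
  free : ∀ x : Fin n, L ≤ x → x < R → ρ x = none
  left : L = 0 ∨ ∃ i : Fin n, (i : ℕ) + 1 = L ∧
    ∃ σ, ρ i = some σ ∧ (σ.b = .closeR ∨ σ.b = .trivR)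
  right : R = n ∨ ∃ j : Fin n, (j : ℕ) = R ∧
    ∃ σ, ρ j = some σ ∧ (σ.b = .openB ∨ σ.b = .trivB)

theorem Gap.falsifies {n : ℕ} (hn : 2 ≤ n) {ρ : PState n} {L : ℕ} (h : Gap ρ L L) :
    Falsifies ρ := by
  rcases h.left with h0 | ⟨i, hi, σ, hσ, hσb⟩
  · rcases h.right with h1 | ⟨j, hj, τ, hτ, hτb⟩
    · omega
    · refine Or.inl (Or.inl ⟨j, by omega, τ, hτ, ?_⟩)
      rcases hτb with e | e <;> simp [e]
  · rcases h.right with h1 | ⟨j, hj, τ, hτ, hτb⟩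
    · refine Or.inl (Or.inr ⟨i, by omega, σ, hσ, ?_⟩)
      rcases hσb with e | e <;> simp [e]
    · exact Or.inr (Or.inr (Or.inr ⟨i, j, by omega, σ, τ, hσ, hτ, hσb, hτb⟩))

theorem closed_addBlock {n : ℕ} {ρ : PState n} {red : Bool} {a b : Fin n}
    (h : ∀ i σ, ρ i = some σ → ρ σ.p ≠ none) (i : Fin n) (σ : Sym n)
    (hi : addBlock ρ red a b i = some σ) : addBlock ρ red a b σ.p ≠ none := by
  intro hnone
  obtain ⟨hpa, hpb, hp⟩ := addBlock_eq_none hnone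
  by_cases hia : i = a
  · subst hia
    rw [addBlock_left, Option.some.injEq] at hi
    exact hpb (by rw [← hi, leftSym])
  by_cases hib : i = b
  · subst hib
    rw [addBlock_right, Option.some.injEq] at hi
    exact hpa (by rw [← hi, rightSym])
  rw [addBlock_of_ne hia hib] at hi
  exact h i σ hi hp

/-- A red block in the gap leaves the part of the gap to its right. -/
theorem Gap.addBlock_red {n : ℕ} {ρ : PState n} {L R : ℕ} (h : Gap ρ L R) {a b : Fin n}
    (ha : L ≤ a) (hab : a ≤ b) (hb : b < R) : Gap (addBlock ρ true a b) (b + 1) R where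
  le := hb
  le_length := h.le_length
  closed := closed_addBlock h.closed
  free x hx hxR := by
    rw [Fin.le_def] at hab
    rw [addBlock_of_ne (Fin.ne_of_val_ne (by omega)) (Fin.ne_of_val_ne (by omega))]
    exact h.free x (by omega) hxR
  left := Or.inr ⟨b, rfl, _, addBlock_right, by by_cases e : a = b <;> simp [rightSym, e]⟩
  right := h.right.imp_right fun ⟨j, hj, σ, hσ, hσb⟩ => ⟨j, hj, σ, addBlock_of_some
    (h.free a ha (lt_of_le_of_lt hab hb)) (h.free b (ha.trans hab) hb) hσ, hσb⟩

/-- A blue block in the gap leaves the part of the gap to its left. -/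
theorem Gap.addBlock_blue {n : ℕ} {ρ : PState n} {L R : ℕ} (h : Gap ρ L R) {a b : Fin n}
    (ha : L ≤ a) (hab : a ≤ b) (hb : b < R) : Gap (addBlock ρ false a b) L a where
  le := ha
  le_length := a.isLt.le
  closed := closed_addBlock h.closed
  free x hx hxa := by
    rw [Fin.le_def] at hab
    rw [addBlock_of_ne (Fin.ne_of_val_ne (by omega)) (Fin.ne_of_val_ne (by omega))]
    exact h.free x hx (by omega)
  left := h.left.imp_right fun ⟨j, hj, σ, hσ, hσb⟩ => ⟨j, hj, σ, addBlock_of_some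
    (h.free a ha (lt_of_le_of_lt hab hb)) (h.free b (ha.trans hab) hb) hσ, hσb⟩
  right := Or.inr ⟨a, rfl, _, addBlock_left, by by_cases e : a = b <;> simp [leftSym, e]⟩

/-- Two stored ends that point at each other either form a block or falsify an axiom. -/
theorem falsifies_or_eq_addBlock {n : ℕ} {ρ : PState n} {a b : Fin n} (hab : a < b)
    {σ τ : Sym n} (hσ : σ.p = b) (hτ : τ.p = a) :
    Falsifies (Function.update (Function.update ρ b (some τ)) a (some σ)) ∨
    ∃ red, Function.update (Function.update ρ b (some τ)) a (some σ) = addBlock ρ red a b := by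
  by_cases h : (σ.b = .openR ∧ τ.b = .closeR) ∨ (σ.b = .openB ∧ τ.b = .closeB)
  · obtain ⟨s, p⟩ := σ
    obtain ⟨t, q⟩ := τ
    simp only at hσ hτ h
    subst hσ hτ
    right
    rcases h with ⟨rfl, rfl⟩ | ⟨rfl, rfl⟩
    · exact ⟨true, by simp [addBlock, leftSym, rightSym, hab.ne]⟩
    · exact ⟨false, by simp [addBlock, leftSym, rightSym, hab.ne]⟩
  · exact Or.inl (Or.inr (Or.inl (Or.inr (Or.inr
      ⟨a, b, σ, τ, hab, by simp, by simp [hab.ne'], hσ, hτ, h⟩))))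

/-- To win it suffices to query a free position and its partner and to win from every block that
can be found this way. -/
theorem wins_of_forall_addBlock {n M : ℕ} {ρ : PState n} (hM : memSize ρ + 2 ≤ M)
    (hclosed : ∀ i σ, ρ i = some σ → ρ σ.p ≠ none) {m : Fin n} (hm : ρ m = none)
    (h : ∀ red a b, a ≤ b → (a = m ∨ b = m) → ρ a = none → ρ b = none →
      Wins M (addBlock ρ red a b)) :
    Wins M ρ := by
  refine .query m (by omega) fun σ => ?_
  have hM1 : memSize (Function.update ρ m (some σ)) + 1 ≤ M := by
    have := memSize_update_le ρ m (some σ)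
    omega
  by_cases hself : σ.p = m
  · by_cases htriv : σ.b = .trivR ∨ σ.b = .trivB
    · obtain ⟨s, p⟩ := σ
      simp only at hself htriv
      subst hself
      rcases htriv with rfl | rfl
      · simpa [addBlock, leftSym] using h true p p le_rfl (Or.inl rfl) hm hm
      · simpa [addBlock, leftSym] using h false p p le_rfl (Or.inl rfl) hm hm
    · exact .done (by omega)
        (Or.inr (Or.inl (Or.inr (Or.inl ⟨m, σ, by simp, hself, htriv⟩))))
  · rcases hp : ρ σ.p with _ | τ
    · refine .query σ.p (by omega) fun τ => ?_
      have hM2 := memSize_update_le (Function.update ρ m (some σ)) σ.p (some τ)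
      by_cases hτ : τ.p = m
      · rcases lt_or_gt_of_ne hself with hlt | hlt
        · rcases falsifies_or_eq_addBlock (ρ := ρ) hlt hτ rfl with hF | ⟨red, e⟩
          · exact .done (by omega) hF
          · rw [e]
            exact h red _ _ hlt.le (Or.inr rfl) hp hm
        · rw [Function.update_comm (Ne.symm hself)] at hM2 ⊢
          rcases falsifies_or_eq_addBlock (ρ := ρ) hlt rfl hτ with hF | ⟨red, e⟩
          · exact .done (by omega) hF
          · rw [e]
            exact h red _ _ hlt.le (Or.inl rfl) hm hp
      · refine .done (by omega) (Or.inr (Or.inl (Or.inl ⟨m, σ.p, σ, τ, ?_, by simp, rfl, hτ⟩)))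
        simp [Ne.symm hself]
    · refine .done (by omega) (Or.inr (Or.inl (Or.inl ⟨m, σ.p, σ, τ, by simp, ?_, rfl, ?_⟩)))
      · simpa [hself] using hp
      · rintro e
        exact hclosed _ _ hp (e ▸ hm)

/-- The prover wins from a gap of length less than `2 ^ k`, provided that it wins as soon as a block
with one end inside the gap and the other end outside has been found. -/
theorem Gap.wins {n M : ℕ} (hn : 2 ≤ n) (k : ℕ) : ∀ {ρ : PState n} {L R : ℕ}, Gap ρ L R →
    R - L < 2 ^ k → memSize ρ + 2 * (k + 1) ≤ M →
    (∀ red (a b : Fin n), a ≤ b → ρ a = none → ρ b = none →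
      ((L ≤ a ∧ (a : ℕ) < R) ∨ (L ≤ b ∧ (b : ℕ) < R)) → ¬ (L ≤ a ∧ (b : ℕ) < R) →
      Wins M (addBlock ρ red a b)) →
    Wins M ρ := by
  induction k with
  | zero =>
    intro ρ L R hgap hlen hM _
    have hle := hgap.le
    obtain rfl : R = L := by omega
    exact .done (by omega) (hgap.falsifies hn)
  | succ k ih =>
    intro ρ L R hgap hlen hM hesc
    have hle := hgap.le
    rcases hle.eq_or_lt with rfl | hlt
    · exact .done (by omega) (hgap.falsifies hn)
    have hRn := hgap.le_length
    obtain ⟨m, hm⟩ : ∃ m : Fin n, (m : ℕ) = (L + R) / 2 := ⟨⟨(L + R) / 2, by omega⟩, rfl⟩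
    rw [pow_succ] at hlen
    have hinner : ∀ w red (a b : Fin n), a ≤ m → m ≤ b → L ≤ a → (b : ℕ) < R →
        n ≤ w + (b - a) → Wins M (addBlock ρ red a b) := by
      intro w
      induction w with
      | zero => intro red a b _ _ _ _ _; omega
      | succ w ihw =>
        intro red a b ham hmb hLa hbR hw
        rw [Fin.le_def] at ham hmb
        have hab : a ≤ b := Fin.le_def.2 (ham.trans hmb)
        have ha : ρ a = none := hgap.free a hLa (by omega)
        have hb : ρ b = none := hgap.free b (by omega) hbR
        have hM1 : memSize (addBlock ρ red a b) ≤ memSize ρ + 2 := memSize_addBlock_le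
        have hforget : ∀ red' (d e : Fin n), addBlock ρ red a b d = none →
            addBlock ρ red a b e = none → Wins M (addBlock ρ red' d e) →
            Wins M (addBlock (addBlock ρ red a b) red' d e) := by
          intro red' d e hd he hwin
          have hM2 : memSize (addBlock (addBlock ρ red a b) red' d e) ≤ _ := memSize_addBlock_le
          refine .forget {a, b} (by omega) ?_
          rwa [forget_addBlock_addBlock ha hb hd he]
        have hpair : ∀ {red' : Bool} {d e : Fin n}, addBlock ρ red a b d = none →
            addBlock ρ red a b e = none →
            Paired (addBlock (addBlock ρ red a b) red' d e) a b :=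
          fun hd he => paired_addBlock.addBlock hd he
        cases red with
        | true =>
          refine ih (hgap.addBlock_red hLa hab hbR) (by omega) (by omega) ?_
          intro red' d e hde hd he hmeet hout
          obtain ⟨hda, hdb, hd0⟩ := addBlock_eq_none hd
          obtain ⟨-, -, he0⟩ := addBlock_eq_none he
          rw [Fin.le_def] at hde
          by_cases hin : L ≤ d ∧ (e : ℕ) < R
          · have hda' := Fin.val_ne_of_ne hda
            have hdb' := Fin.val_ne_of_ne hdb
            by_cases had : a < d
            · rw [Fin.lt_def] at had
              have hM2 : memSize (addBlock (addBlock ρ true a b) red' d e) ≤ _ :=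
                memSize_addBlock_le
              refine .done (by omega) (Or.inr (Or.inr (Or.inl
                ⟨a, d, b, e, hpair hd he, paired_addBlock, ?_, ?_, ?_⟩))) <;>
                rw [Fin.lt_def] <;> omega
            · rw [Fin.lt_def] at had
              exact hforget red' d e hd he (ihw red' d e (Fin.le_def.2 (by omega))
                (Fin.le_def.2 (by omega)) hin.1 hin.2 (by omega))
          · exact hforget red' d e hd he
              (hesc red' d e (Fin.le_def.2 hde) hd0 he0 (by omega) hin)
        | false =>
          refine ih (hgap.addBlock_blue hLa hab hbR) (by omega) (by omega) ?_
          intro red' d e hde hd he hmeet hout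
          obtain ⟨-, -, hd0⟩ := addBlock_eq_none hd
          obtain ⟨hea, heb, he0⟩ := addBlock_eq_none he
          rw [Fin.le_def] at hde
          by_cases hin : L ≤ d ∧ (e : ℕ) < R
          · have hea' := Fin.val_ne_of_ne hea
            have heb' := Fin.val_ne_of_ne heb
            by_cases heb_lt : e < b
            · rw [Fin.lt_def] at heb_lt
              have hM2 : memSize (addBlock (addBlock ρ false a b) red' d e) ≤ _ :=
                memSize_addBlock_le
              refine .done (by omega) (Or.inr (Or.inr (Or.inl
                ⟨d, a, e, b, paired_addBlock, hpair hd he, ?_, ?_, ?_⟩))) <;>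
                rw [Fin.lt_def] <;> omega
            · rw [Fin.lt_def] at heb_lt
              exact hforget red' d e hd he (ihw red' d e (Fin.le_def.2 (by omega))
                (Fin.le_def.2 (by omega)) hin.1 hin.2 (by omega))
          · exact hforget red' d e hd he
              (hesc red' d e (Fin.le_def.2 hde) hd0 he0 (by omega) hin)
    refine wins_of_forall_addBlock (by omega) hgap.closed
      (hgap.free m (by omega) (by omega)) fun red a b hab hmem ha hb => ?_
    have hmeet : (L ≤ a ∧ (a : ℕ) < R) ∨ (L ≤ b ∧ (b : ℕ) < R) := by
      rcases hmem with rfl | rfl <;> omega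
    by_cases hin : L ≤ a ∧ (b : ℕ) < R
    · refine hinner n red a b ?_ ?_ hin.1 hin.2 (by omega)
      · rcases hmem with rfl | rfl
        · exact le_rfl
        · exact hab
      · rcases hmem with rfl | rfl
        · exact hab
        · exact le_rfl
    · exact hesc red a b hab ha hb hmeet hin

/-- The prover wins from the empty state with memory `2 (⌊log₂ n⌋ + 2)`. -/
theorem wins_empty {n : ℕ} (hn : 2 ≤ n) :
    Wins (2 * (Nat.log 2 n + 2)) (fun _ => none : PState n) := by
  have hgap : Gap (fun _ => none : PState n) 0 n :=
    ⟨Nat.zero_le _, le_rfl, by simp, by simp, Or.inl rfl, Or.inl rfl⟩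
  refine hgap.wins hn (Nat.log 2 n + 1) (Nat.lt_pow_succ_log_self one_lt_two n)
    (by simp [memSize]) ?_
  intro red a b _ _ _ _ hout
  exact absurd ⟨Nat.zero_le _, b.isLt⟩ hout

/-- In the prover-adversary game for the bracket axioms, the prover
can force the game to end while keeping the memory size at most `O(log n)`. -/
theorem prover_wins_with_log_memory :
    ∃ a : ℝ, 0 < a ∧ ∀ n : ℕ, 2 ≤ n →
      ∃ P : ProverStrat n, ∀ A : AdvStrat n, ∃ T : ℕ,
        Falsifies (stateOf (play P A T)) ∧
        ∀ t ≤ T, (memSize (stateOf (play P A t)) : ℝ) ≤ a * Real.log n := by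
  refine ⟨6 / Real.log 2, by positivity, fun n hn => ?_⟩
  obtain ⟨P, hP⟩ := (wins_empty hn).exists_strategy
  refine ⟨P, fun A => ?_⟩
  obtain ⟨T, hF, hT⟩ := hP A
  refine ⟨T, hF, fun t ht => ?_⟩
  have hlog : (Nat.log 2 n : ℝ) ≤ Real.logb 2 n := by
    exact_mod_cast Real.natLog_le_logb n 2
  have hone : (1 : ℝ) ≤ Real.logb 2 n := by
    rw [Real.le_logb_iff_rpow_le one_lt_two (by positivity)]
    simpa using (by exact_mod_cast hn : (2 : ℝ) ≤ n)
  calc (memSize (stateOf (play P A t)) : ℝ) ≤ (2 * (Nat.log 2 n + 2) : ℕ) := by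
        exact_mod_cast hT t ht
    _ ≤ 6 * Real.logb 2 n := by
        push_cast
        linarith
    _ = 6 / Real.log 2 * Real.log n := by
        rw [Real.logb]
        ring

end Paper
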